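/- arXiv:2007.13550 — 2 statements merged into one kernel-verified Lean document; each statement's English description precedes it below -/
import Mathlib

section
/- There exist two families 𝒴₁, 𝒴₂ of transcendence bases of ℝ over ℚ with |𝒴₁| = |𝒴₂| = 2^𝔠 such that each member of 𝒴₁ is a nowhere dense Lebesgue null set containing a Cantor set, each member of 𝒴₂ is a Bernstein set, and for each i ∈ {1,2} and distinct R, S ∈ 𝒴ᵢ one has ℚ(R) ⊄ ℚ(S) (in particular ℚ(R) ≠ ℚ(S)). -/
noncomputable section

open Set Cardinal

/-- A Cantor set: a nonempty compact subset of ℝ that is totally disconnected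
and dense in itself (no isolated points). -/
def IsCantorSet (C : Set ℝ) : Prop :=
  C.Nonempty ∧ IsCompact C ∧ IsTotallyDisconnected C ∧ Preperfect C

/-- A Bernstein set: neither it nor its complement contains a Cantor set. -/
def IsBernsteinSet (B : Set ℝ) : Prop :=
  (¬ ∃ C ⊆ B, IsCantorSet C) ∧ (¬ ∃ C ⊆ Bᶜ, IsCantorSet C)

/-- A set `S ⊆ ℝ` is algebraically independent (over ℚ). -/
def AlgIndepSet (S : Set ℝ) : Prop := AlgebraicIndependent ℚ ((↑) : S → ℝ)

/-- A transcendence base of ℝ over ℚ: a maximal algebraically independent subset. -/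
def IsTransBase (S : Set ℝ) : Prop :=
  AlgIndepSet S ∧ ∀ x : ℝ, x ∉ S → ¬ AlgIndepSet (insert x S)

theorem exists_mem_transcendental_adjoin {s C : Set ℝ} (hs : #s < 𝔠) (hC : 𝔠 ≤ #C) :
    ∃ a ∈ C, Transcendental (Algebra.adjoin ℚ s) a := by
  by_contra! h
  have hsub : C ⊆ {a : ℝ | IsAlgebraic (Algebra.adjoin ℚ s) a} := fun a ha ↦ by
    simpa [Transcendental] using h a ha
  have hadj : #(Algebra.adjoin ℚ s) < 𝔠 :=
    (Algebra.cardinalMk_adjoin_le ℚ s).trans_lt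
      (max_lt (max_lt (by simp [aleph0_lt_continuum]) hs) aleph0_lt_continuum)
  exact (hC.trans (mk_le_mk_of_subset hsub)).not_gt
    ((Algebraic.cardinalMk_le_max (Algebra.adjoin ℚ s) ℝ).trans_lt
      (max_lt hadj aleph0_lt_continuum))

theorem algebraicIndependent_of_wellFoundedLT {ι : Type*} [LinearOrder ι] {x : ι → ℝ}
    (h : ∀ i, Transcendental (Algebra.adjoin ℚ (x '' Iio i)) (x i)) :
    AlgebraicIndependent ℚ x := by
  refine algebraicIndependent_of_finite_type fun t ht ↦ ?_
  lift t to Finset ι using ht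
  induction t using Finset.induction_on_max with
  | empty =>
    have : IsEmpty ((∅ : Finset ι) : Set ι) := by simp
    exact algebraicIndependent_empty_type_iff.mpr (algebraMap ℚ ℝ).injective
  | insert a s ha ih =>
    rw [Finset.coe_insert]
    refine (AlgebraicIndepOn.insert_iff fun has ↦ (ha a has).false).mpr ⟨ih, ?_⟩
    exact (h a).of_tower_top_of_subalgebra_le (Algebra.adjoin_mono (image_mono ha))

theorem exists_algebraicIndependent_mem {ι : Type} (hι : #ι ≤ 𝔠) {C : ι → Set ℝ}
    (hC : ∀ i, 𝔠 ≤ #(C i)) : ∃ x : ι → ℝ, AlgebraicIndependent ℚ x ∧ ∀ i, x i ∈ C i := by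
  obtain ⟨_, wf, hord⟩ := exists_ord_eq_type_lt ι
  have key (i : ι) (f : Iio i → ℝ) :
      ∃ a ∈ C i, Transcendental (Algebra.adjoin ℚ (range f)) a :=
    exists_mem_transcendental_adjoin
      (mk_range_le.trans_lt ((mk_Iio_lt i hord).trans_le hι)) (hC i)
  choose g hgC hg using key
  let x : ι → ℝ := wf.wf.fix fun i f ↦ g i fun j ↦ f j.1 j.2
  have hx (i : ι) : x i = g i fun j ↦ x j := wf.wf.fix_eq _ _
  refine ⟨x, algebraicIndependent_of_wellFoundedLT fun i ↦ ?_, fun i ↦ hx i ▸ hgC i _⟩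
  rw [hx, image_eq_range]
  exact hg i _

theorem isTransBase_iff_isTranscendenceBasis {S : Set ℝ} :
    IsTransBase S ↔ IsTranscendenceBasis ℚ ((↑) : S → ℝ) := by
  rw [isTranscendenceBasis_iff_maximal, Set.maximal_iff_forall_insert fun _ _ h hst ↦ h.mono hst]
  rfl

/-- The set obtained from `T` by raising each `t ∈ T` to the power `n t`. -/
def powImage (T : Set ℝ) (n : T → ℕ) : Set ℝ := range fun t : T ↦ (t : ℝ) ^ n t

theorem IsTranscendenceBasis.powImage {T : Set ℝ}
    (hT : IsTranscendenceBasis ℚ ((↑) : T → ℝ)) {n : T → ℕ} (hn : ∀ t, n t ≠ 0) :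
    IsTranscendenceBasis ℚ ((↑) : powImage T n → ℝ) := by
  have hind : AlgebraicIndependent ℚ fun t : T ↦ (t : ℝ) ^ n t := by
    simpa using hT.1.polynomial_aeval_of_transcendental (f := fun t ↦ .X ^ n t)
      fun t ↦ (Polynomial.transcendental_X ℚ).pow (Nat.pos_of_ne_zero (hn t))
  refine IsTranscendenceBasis.to_subtype_range (x := fun t : T ↦ (t : ℝ) ^ n t) ?_
  rw [hind.isTranscendenceBasis_iff_isAlgebraic]
  have := hT.isAlgebraic
  refine ⟨fun a ↦ (this.1 a).adjoin_of_forall_isAlgebraic ?_⟩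
  rintro _ ⟨⟨t, rfl⟩, -⟩
  refine IsAlgebraic.of_pow (Nat.pos_of_ne_zero (hn t)) ?_
  exact isAlgebraic_algebraMap (⟨_, Algebra.subset_adjoin ⟨t, rfl⟩⟩ :
    Algebra.adjoin ℚ (range fun t : T ↦ (t : ℝ) ^ n t))

theorem Transcendental.pow_notMem_adjoin_pow {F E : Type*} [Field F] [Field E] [Algebra F E]
    {t : E} (ht : Transcendental F t) {a b : ℕ} (hb : b ≠ 0) (hab : ¬ b ∣ a) :
    t ^ a ∉ IntermediateField.adjoin F {t ^ b} := by
  rw [IntermediateField.mem_adjoin_simple_iff]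
  rintro ⟨r, s, h⟩
  have ht0 : t ≠ 0 := fun h0 ↦ ht (h0 ▸ isAlgebraic_zero)
  have hs : Polynomial.aeval (t ^ b) s ≠ 0 := fun hs ↦ pow_ne_zero a ht0 (by simpa [hs] using h)
  rw [eq_div_iff hs] at h
  have hpoly : Polynomial.X ^ a * Polynomial.expand F b s = Polynomial.expand F b r := by
    refine transcendental_iff_injective.mp ht ?_
    simpa [Polynomial.expand_aeval] using h
  have hs0 : s ≠ 0 := by rintro rfl; simp at hs
  have hdeg := congrArg Polynomial.natDegree hpoly
  rw [Polynomial.natDegree_mul (pow_ne_zero _ Polynomial.X_ne_zero)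
    ((Polynomial.expand_ne_zero (Nat.pos_of_ne_zero hb)).mpr hs0), Polynomial.natDegree_X_pow,
    Polynomial.natDegree_expand, Polynomial.natDegree_expand] at hdeg
  exact hab ((Nat.dvd_add_left (dvd_mul_left b _)).mp (hdeg ▸ dvd_mul_left b _))

theorem not_closure_powImage_le {T : Set ℝ} (hT : AlgebraicIndependent ℚ ((↑) : T → ℝ))
    {m n : T → ℕ} {t : T} (hn : n t ≠ 0) (h : ¬ n t ∣ m t) :
    ¬ Subfield.closure (powImage T m) ≤ Subfield.closure (powImage T n) := by
  intro hle
  let F := IntermediateField.adjoin ℚ ((↑) '' ({t}ᶜ : Set T) : Set ℝ)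
  have ht : Transcendental F (t : ℝ) := by
    have := hT.transcendental_adjoin (s := {t}ᶜ) (i := t) (by simp)
    exact IntermediateField.transcendental_adjoin_iff.mpr this
  have hsub : Subfield.closure (powImage T n) ≤
      (IntermediateField.adjoin F {(t : ℝ) ^ n t}).toSubfield := by
    rw [Subfield.closure_le]
    rintro _ ⟨u, rfl⟩
    obtain rfl | hu := eq_or_ne u t
    · exact IntermediateField.mem_adjoin_simple_self F _
    · exact pow_mem ((IntermediateField.adjoin F {(t : ℝ) ^ n t}).algebraMap_mem
        ⟨u, IntermediateField.subset_adjoin _ _ ⟨u, hu, rfl⟩⟩) _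
  exact ht.pow_notMem_adjoin_pow hn h (hsub (hle (Subfield.subset_closure ⟨t, rfl⟩)))

/-- The exponent function equal to `2` or `3` on `A`, as prescribed by `f`, and `1` elsewhere. -/
def exponent {T : Set ℝ} (A : Set T) (f : A → Bool) (t : T) : ℕ :=
  open Classical in if h : t ∈ A then bif f ⟨t, h⟩ then 2 else 3 else 1

theorem exponent_ne_zero {T : Set ℝ} (A : Set T) (f : A → Bool) (t : T) : exponent A f t ≠ 0 := by
  unfold exponent
  split_ifs with h
  · cases f ⟨t, h⟩ <;> simp
  · simp

theorem exists_antichain_family {T : Set ℝ} (hT : IsTranscendenceBasis ℚ ((↑) : T → ℝ))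
    {A : Set T} (hA : #A = 𝔠) :
    ∃ Y : Set (Set ℝ), #Y = 2 ^ 𝔠 ∧ (∀ S ∈ Y, IsTransBase S) ∧
      (∀ S ∈ Y, (↑) '' Aᶜ ⊆ S ∧ ∀ x ∈ S, ∃ t ∈ T, x = t ∨ x = t ^ 2 ∨ x = t ^ 3) ∧
      ∀ R ∈ Y, ∀ S ∈ Y, R ≠ S → ¬ Subfield.closure R ≤ Subfield.closure S := by
  have hne {f g : A → Bool} (hfg : f ≠ g) :
      ¬ Subfield.closure (powImage T (exponent A f)) ≤
        Subfield.closure (powImage T (exponent A g)) := by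
    obtain ⟨t, ht⟩ := Function.ne_iff.mp hfg
    refine not_closure_powImage_le hT.1 (exponent_ne_zero A g t) ?_
    cases hf : f t <;> cases hg : g t <;> simp_all [exponent]
  have hinj : Function.Injective fun f : A → Bool ↦ powImage T (exponent A f) := fun f g h ↦ by
    by_contra hfg
    exact hne hfg (congrArg Subfield.closure h).le
  refine ⟨range fun f : A → Bool ↦ powImage T (exponent A f), ?_, ?_, ?_, ?_⟩
  · rw [mk_range_eq _ hinj]
    simp [hA]
  · rintro _ ⟨f, rfl⟩
    exact isTransBase_iff_isTranscendenceBasis.mpr (hT.powImage (exponent_ne_zero A f))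
  · rintro _ ⟨f, rfl⟩
    refine ⟨?_, ?_⟩
    · rintro _ ⟨t, ht, rfl⟩
      exact ⟨t, by simp [exponent, show t ∉ A from ht]⟩
    · rintro _ ⟨t, rfl⟩
      refine ⟨t, t.2, ?_⟩
      by_cases h : t ∈ A
      · cases hf : f ⟨t, h⟩ <;> simp [exponent, h, hf]
      · simp [exponent, h]
  · rintro _ ⟨f, rfl⟩ _ ⟨g, rfl⟩ h
    exact hne fun hfg ↦ h (hfg ▸ rfl)

/-- The first `k` terms of a binary sequence. -/
def initialSegment (k : ℕ) (x : ℕ → Bool) : Fin k → Bool := fun i ↦ x i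

theorem continuous_initialSegment (k : ℕ) : Continuous (initialSegment k) := by
  unfold initialSegment
  fun_prop

theorem Continuous.exists_initialSegment_dist_lt {φ : (ℕ → Bool) → ℝ} (hφ : Continuous φ)
    {ε : ℝ} (hε : 0 < ε) :
    ∃ m, ∀ x y, initialSegment m x = initialSegment m y → dist (φ x) (φ y) < ε := by
  let _ : MetricSpace (ℕ → Bool) := PiNat.metricSpaceOfDiscreteUniformity fun _ ↦ rfl
  obtain ⟨δ, hδ, h⟩ := Metric.uniformContinuous_iff.mp
    (CompactSpace.uniformContinuous_of_continuous hφ) ε hε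
  obtain ⟨m, hm⟩ := exists_pow_lt_of_lt_one hδ (by norm_num : (1 / 2 : ℝ) < 1)
  refine ⟨m, fun x y hxy ↦ h (lt_of_le_of_lt ?_ hm)⟩
  exact PiNat.mem_cylinder_iff_dist_le.mp
    (PiNat.mem_cylinder_iff.mpr fun i hi ↦ congrFun hxy ⟨i, hi⟩)

theorem exists_injOn_initialSegment (t : Finset (ℕ → Bool)) :
    ∃ k, InjOn (initialSegment k) t := by
  have h : ∀ᶠ k in Filter.atTop, ∀ x ∈ t, ∀ y ∈ t,
      initialSegment k x = initialSegment k y → x = y := by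
    simp_rw [Filter.eventually_all_finset]
    intro x _ y _
    by_cases hxy : x = y
    · simp [hxy]
    obtain ⟨i, hi⟩ := Function.ne_iff.mp hxy
    filter_upwards [Filter.eventually_gt_atTop i] with k hk h
    exact absurd (congrFun h ⟨i, hk⟩) hi
  exact h.exists

/-- The continuous functions on the Cantor space at whose values `p` does not vanish, for all
tuples of points which are distinguished by their first `k` terms. -/
def nonvanishingFunctions {n : ℕ} (p : MvPolynomial (Fin n) ℚ) (k : ℕ) : Set C(ℕ → Bool, ℝ) :=
  {φ | ∀ x : Fin n → ℕ → Bool, Function.Injective (initialSegment k ∘ x) →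
    MvPolynomial.aeval (φ ∘ x) p ≠ 0}

theorem isOpen_nonvanishingFunctions {n : ℕ} (p : MvPolynomial (Fin n) ℚ) (k : ℕ) :
    IsOpen (nonvanishingFunctions p k) := by
  let K : Set (Fin n → ℕ → Bool) := {x | Function.Injective (initialSegment k ∘ x)}
  have hK : IsCompact K := by
    have hcont : Continuous fun x : Fin n → ℕ → Bool ↦ fun i ↦ initialSegment k (x i) :=
      continuous_pi fun i ↦ (continuous_initialSegment k).comp (continuous_apply i)
    exact ((isClosed_discrete {f : Fin n → Fin k → Bool | Function.Injective f}).preimage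
      hcont).isCompact
  have heval : Continuous fun q : C(ℕ → Bool, ℝ) × (Fin n → ℕ → Bool) ↦
      MvPolynomial.aeval (q.1 ∘ q.2) p := by
    simp_rw [MvPolynomial.aeval_def, MvPolynomial.eval₂_eq, Function.comp_apply]
    fun_prop
  rw [isOpen_iff_eventually]
  intro φ hφ
  exact hK.eventually_forall_of_forall_eventually fun x hx ↦
    (heval.continuousAt (x := (φ, x))).eventually_ne (hφ x hx)

theorem dense_nonvanishingFunctions {n : ℕ} {p : MvPolynomial (Fin n) ℚ} (hp : p ≠ 0) (k : ℕ) :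
    Dense (nonvanishingFunctions p k) := by
  rw [Metric.dense_iff]
  intro φ r hr
  obtain ⟨l, hl⟩ := φ.continuous.exists_initialSegment_dist_lt (half_pos hr)
  let m := max k l
  let e (s : Fin m → Bool) (i : ℕ) : Bool := if h : i < m then s ⟨i, h⟩ else false
  have he (x : ℕ → Bool) : initialSegment l (e (initialSegment m x)) = initialSegment l x := by
    ext i
    simp [initialSegment, e, m]
  obtain ⟨c, hc, hcφ⟩ := exists_algebraicIndependent_mem (ι := Fin m → Bool)
    ((mk_lt_aleph0).le.trans aleph0_le_continuum)
    (C := fun s ↦ Ioo (φ (e s) - r / 2) (φ (e s) + r / 2))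
    fun s ↦ (mk_Ioo_real (by linarith)).ge
  refine ⟨⟨fun x ↦ c (initialSegment m x),
    continuous_of_discreteTopology.comp (continuous_initialSegment m)⟩, ?_, fun x hx ↦ ?_⟩
  · rw [Metric.mem_ball, ContinuousMap.dist_lt_iff hr]
    intro x
    have h₁ := hl _ _ (he x)
    have h₂ := hcφ (initialSegment m x)
    rw [Real.dist_eq, abs_lt] at *
    simp only [ContinuousMap.coe_mk, mem_Ioo] at *
    constructor <;> linarith
  · have hinj : Function.Injective (initialSegment m ∘ x) := fun i j hij ↦ hx <| by
      ext a
      exact congrFun hij (Fin.castLE (le_max_left k l) a)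
    exact fun h ↦ hp ((hc.comp _ hinj).eq_zero_of_aeval_eq_zero p h)

/-- A generic continuous function on the Cantor space has algebraically independent values. -/
theorem exists_continuous_algebraicIndependent :
    ∃ φ : (ℕ → Bool) → ℝ, Continuous φ ∧ AlgebraicIndependent ℚ φ := by
  let ι := (Σ n : ℕ, {p : MvPolynomial (Fin n) ℚ // p ≠ 0}) × ℕ
  have hcount (n : ℕ) : Countable (MvPolynomial (Fin n) ℚ) :=
    mk_le_aleph0_iff.mp (MvPolynomial.cardinalMk_le_max.trans (by simp))
  obtain ⟨φ, hφ⟩ := (dense_iInter_of_isOpen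
    (fun i : ι ↦ isOpen_nonvanishingFunctions i.1.2.1 i.2)
    fun i : ι ↦ dense_nonvanishingFunctions i.1.2.2 i.2).nonempty
  rw [mem_iInter] at hφ
  refine ⟨φ, φ.continuous, algebraicIndependent_of_finite_type fun t ht ↦ ?_⟩
  lift t to Finset (ℕ → Bool) using ht
  obtain ⟨k, hk⟩ := exists_injOn_initialSegment t
  let e := t.equivFin.symm
  refine (algebraicIndependent_equiv e).mp (algebraicIndependent_iff.mpr fun p hp ↦ ?_)
  by_contra hp0
  exact hφ (⟨_, p, hp0⟩, k) (fun i ↦ e i)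
    (fun i j hij ↦ e.injective (Subtype.ext (hk (e i).2 (e j).2 hij))) hp

theorem eq_zero_of_algIndepSet_of_eq_add {S : Set ℝ} (hS : AlgIndepSet S) {a b : ℝ} (ha : a ∈ S)
    (hb : b ∈ S) {q : ℚ} (h : a = b + q) : q = 0 := by
  by_contra hq
  have hab : (⟨a, ha⟩ : S) ∉ ({⟨b, hb⟩} : Set S) := by simpa [h] using hq
  have hmem : a ∈ Algebra.adjoin ℚ (((↑) : S → ℝ) '' {⟨b, hb⟩}) :=
    h ▸ add_mem (Algebra.subset_adjoin (by simp)) (Subalgebra.algebraMap_mem _ q)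
  exact hS.transcendental_adjoin hab (isAlgebraic_algebraMap (⟨a, hmem⟩ : Algebra.adjoin ℚ _))

theorem volume_eq_zero_of_algIndepSet {S : Set ℝ} (hS : AlgIndepSet S) (hm : MeasurableSet S) :
    MeasureTheory.volume S = 0 := by
  by_contra h
  have hnhds := MeasureTheory.Measure.sub_mem_nhds_zero_of_addHaar_pos MeasureTheory.volume S hm
    (pos_iff_ne_zero.mpr h)
  obtain ⟨n, hn⟩ := (tendsto_one_div_add_atTop_nhds_zero_nat.eventually hnhds).exists
  obtain ⟨a, ha, b, hb, hab⟩ := hn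
  have := eq_zero_of_algIndepSet_of_eq_add hS ha hb (q := 1 / (n + 1)) (by
    push_cast
    linarith)
  exact absurd this (by positivity)

theorem isCantorSet_range {φ : (ℕ → Bool) → ℝ} (hφ : Continuous φ) (hinj : Function.Injective φ) :
    IsCantorSet (range φ) := by
  refine ⟨range_nonempty φ, isCompact_range hφ,
    (hφ.isClosedEmbedding hinj).isEmbedding.isTotallyDisconnected_range.mpr inferInstance, ?_⟩
  rw [preperfect_iff_nhds]
  rintro _ ⟨x, rfl⟩ U hU
  have hlim : Filter.Tendsto (fun n ↦ Function.update x n (!x n)) Filter.atTop (nhds x) := by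
    rw [tendsto_pi_nhds]
    intro i
    refine tendsto_const_nhds.congr' ?_
    filter_upwards [Filter.eventually_gt_atTop i] with n hn
    rw [Function.update_of_ne hn.ne]
  obtain ⟨n, hn⟩ := ((hφ.tendsto x).comp hlim |>.eventually hU).exists
  refine ⟨_, ⟨hn, mem_range_self _⟩, hinj.ne fun h ↦ ?_⟩
  simpa using congrFun h n

theorem IsCantorSet.mk_eq_continuum {C : Set ℝ} (hC : IsCantorSet C) : #C = 𝔠 := by
  refine le_antisymm ((mk_set_le C).trans_eq mk_real) ?_
  obtain ⟨f, hfC, -, hf⟩ :=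
    Perfect.exists_nat_bool_injection ⟨hC.2.1.isClosed, hC.2.2.2⟩ hC.1
  calc 𝔠 = #(ℕ → Bool) := by simp
    _ = #(range f) := (mk_range_eq f hf).symm
    _ ≤ #C := mk_le_mk_of_subset hfC

theorem IsCantorSet.image_homeomorph {C : Set ℝ} (hC : IsCantorSet C) (e : ℝ ≃ₜ ℝ) :
    IsCantorSet (e '' C) := by
  refine ⟨hC.1.image e, hC.2.1.image e.continuous,
    e.isEmbedding.isTotallyDisconnected_image.mpr hC.2.2.1, ?_⟩
  rw [preperfect_iff_nhds]
  rintro _ ⟨x, hx, rfl⟩ U hU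
  obtain ⟨y, ⟨hyU, hyC⟩, hyx⟩ := preperfect_iff_nhds.mp hC.2.2.2 x hx _
    (e.continuous.continuousAt.preimage_mem_nhds hU)
  exact ⟨e y, ⟨hyU, mem_image_of_mem e hyC⟩, e.injective.ne hyx⟩

/-- An algebraically independent set meeting every Cantor set is a Bernstein set: if it contained
a Cantor set `C`, it would miss `C + 1`. -/
theorem isBernsteinSet_of_forall_nonempty_inter {S : Set ℝ} (hS : AlgIndepSet S)
    (h : ∀ C, IsCantorSet C → (S ∩ C).Nonempty) : IsBernsteinSet S := by
  refine ⟨fun ⟨C, hCS, hC⟩ ↦ ?_, fun ⟨C, hCS, hC⟩ ↦ ?_⟩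
  · obtain ⟨_, haS, b, hb, rfl⟩ := h _ (hC.image_homeomorph (Homeomorph.addRight 1))
    exact one_ne_zero (eq_zero_of_algIndepSet_of_eq_add hS haS (hCS hb) (q := 1) (by simp))
  · obtain ⟨a, haS, haC⟩ := h C hC
    exact hCS haC haS

open scoped Pointwise in
theorem volume_cantorSet : MeasureTheory.volume cantorSet = 0 := by
  set μ := (MeasureTheory.volume : MeasureTheory.Measure ℝ)
  have hfin : μ cantorSet ≠ ⊤ := isCompact_cantorSet.measure_lt_top.ne
  have h₁ : μ ((· / 3) '' cantorSet) = ENNReal.ofReal 3⁻¹ * μ cantorSet := by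
    have himage : (· / 3) '' cantorSet = (3⁻¹ : ℝ) • cantorSet := by
      simp_rw [div_eq_inv_mul]
      rfl
    rw [himage, MeasureTheory.Measure.addHaar_smul]
    simp
  have h₂ : μ ((fun x ↦ (2 + x) / 3) '' cantorSet) = μ ((· / 3) '' cantorSet) := by
    have himage : (fun x : ℝ ↦ (2 + x) / 3) '' cantorSet =
        (fun x ↦ 2 / 3 + x) '' ((· / 3) '' cantorSet) := by
      simp_rw [image_image, add_div]
    rw [himage]
    simp [μ]
  have h : μ cantorSet ≤ ENNReal.ofReal (2 / 3) * μ cantorSet := by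
    conv_lhs => rw [cantorSet_eq_union_halves]
    refine (MeasureTheory.measure_union_le _ _).trans_eq ?_
    rw [h₂, h₁, ← add_mul, ← ENNReal.ofReal_add (by norm_num) (by norm_num)]
    norm_num
  by_contra h0
  refine h.not_gt ?_
  conv_rhs => rw [← one_mul (μ cantorSet)]
  exact ENNReal.mul_lt_mul_left h0 hfin (by simp; norm_num)

theorem exists_cantorSet_add_eq_two_mul {x : ℝ} (hx : x ∈ Icc (0 : ℝ) 1) :
    ∃ u ∈ cantorSet, ∃ v ∈ cantorSet, u + v = 2 * x := by
  obtain ⟨a, -, rfl⟩ := Real.ofDigits_SurjOn (b := 3) (by norm_num) hx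
  let u (i : ℕ) : Fin 3 := if a i = 0 then 0 else 2
  let v (i : ℕ) : Fin 3 := if a i = 2 then 2 else 0
  refine ⟨Real.ofDigits u, ofDigits_zero_two_sequence_mem_cantorSet fun i ↦ ?_,
    Real.ofDigits v, ofDigits_zero_two_sequence_mem_cantorSet fun i ↦ ?_, ?_⟩
  · simp only [u]
    split_ifs <;> decide
  · simp only [v]
    split_ifs <;> decide
  · unfold Real.ofDigits
    rw [← Real.summable_ofDigitsTerm.tsum_add Real.summable_ofDigitsTerm, ← tsum_mul_left]
    congr with i
    have huv : (u i : ℕ) + v i = 2 * a i := by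
      simp only [u, v]
      generalize a i = d
      revert d
      decide
    simp only [Real.ofDigitsTerm]
    rw [← add_mul, ← mul_assoc]
    exact_mod_cast congrArg (fun n : ℕ ↦ (n : ℝ) * _) huv

theorem adjoin_cantorSet : Algebra.adjoin ℚ cantorSet = ⊤ := by
  refine eq_top_iff.mpr fun x _ ↦ ?_
  obtain ⟨u, hu, v, hv, huv⟩ := exists_cantorSet_add_eq_two_mul
    (x := Int.fract x) ⟨Int.fract_nonneg x, (Int.fract_lt_one x).le⟩
  have hx : x = (⌊x⌋ : ℝ) + (1 / 2 : ℚ) • (u + v) := by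
    rw [huv, Rat.smul_def]
    push_cast
    linarith [Int.floor_add_fract x]
  rw [hx]
  exact add_mem (intCast_mem _ _) (Subalgebra.smul_mem _
    (add_mem (Algebra.subset_adjoin hu) (Algebra.subset_adjoin hv)) _)

theorem mk_isCantorSet_le : #{C : Set ℝ // IsCantorSet C} ≤ 𝔠 := by
  have h := MeasurableSpace.cardinal_measurableSet_le_continuum
    ((TopologicalSpace.countable_countableBasis ℝ).le_aleph0.trans aleph0_le_continuum)
  rw [← (TopologicalSpace.isBasis_countableBasis ℝ).borel_eq_generateFrom,
    ← BorelSpace.measurable_eq] at h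
  exact (mk_subtype_mono fun _ hC ↦ hC.2.1.measurableSet).trans h

theorem isNowhereDense_and_volume_eq_zero {K S : Set ℝ} (hK : IsCompact K)
    (hK0 : MeasureTheory.volume K = 0) (hS : ∀ x ∈ S, ∃ t ∈ K, x = t ∨ x = t ^ 2 ∨ x = t ^ 3) :
    IsNowhereDense S ∧ MeasureTheory.volume S = 0 := by
  let L := K ∪ (· ^ 2) '' K ∪ (· ^ 3) '' K
  have hSL : S ⊆ L := fun x hx ↦ by
    obtain ⟨t, ht, rfl | rfl | rfl⟩ := hS x hx
    · exact .inl (.inl ht)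
    · exact .inl (.inr ⟨t, ht, rfl⟩)
    · exact .inr ⟨t, ht, rfl⟩
  have hpow (n : ℕ) : MeasureTheory.volume ((fun x : ℝ ↦ x ^ n) '' K) = 0 :=
    MeasureTheory.addHaar_image_eq_zero_of_differentiableOn_of_addHaar_eq_zero _
      (differentiable_pow n).differentiableOn hK0
  have hL0 : MeasureTheory.volume L = 0 := by
    simp [L, hK0, hpow]
  have hL : IsClosed L :=
    ((hK.union (hK.image (continuous_pow 2))).union (hK.image (continuous_pow 3))).isClosed
  exact ⟨(hL.isNowhereDense_iff.mpr
    (MeasureTheory.Measure.interior_eq_empty_of_null hL0)).mono hSL,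
    MeasureTheory.measure_mono_null hSL hL0⟩

theorem exists_family_containing_cantorSet :
    ∃ Y : Set (Set ℝ), #Y = 2 ^ 𝔠 ∧ (∀ S ∈ Y, IsTransBase S) ∧
      (∀ S ∈ Y, IsNowhereDense S ∧ MeasureTheory.volume S = 0 ∧ ∃ C ⊆ S, IsCantorSet C) ∧
      ∀ R ∈ Y, ∀ S ∈ Y, R ≠ S → ¬ Subfield.closure R ≤ Subfield.closure S := by
  obtain ⟨φ, hφ, hind⟩ := exists_continuous_algebraicIndependent
  have hinj : Function.Injective φ := hind.injective
  have hrange : AlgIndepSet (range φ) := hind.coe_range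
  let K := range φ ∪ cantorSet
  have hK : IsCompact K := (isCompact_range hφ).union isCompact_cantorSet
  have hK0 : MeasureTheory.volume K = 0 := MeasureTheory.measure_union_null
    (volume_eq_zero_of_algIndepSet hrange (isCompact_range hφ).measurableSet) volume_cantorSet
  have hadj : Algebra.adjoin ℚ K = ⊤ :=
    top_unique (adjoin_cantorSet.ge.trans (Algebra.adjoin_mono subset_union_right))
  have : Algebra.IsAlgebraic (Algebra.adjoin ℚ K) ℝ := ⟨fun x ↦
    isAlgebraic_algebraMap (⟨x, hadj ▸ Algebra.mem_top⟩ : Algebra.adjoin ℚ K)⟩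
  obtain ⟨T, hφT, hTK, hT⟩ := exists_isTranscendenceBasis_between (R := ℚ) (range φ) K
    subset_union_left hrange
  let cons (b : Bool) (x : ℕ → Bool) (n : ℕ) : Bool := n.casesOn b x
  have hcons (b : Bool) : IsCantorSet (range (φ ∘ cons b)) := by
    refine isCantorSet_range (hφ.comp ?_) (hinj.comp fun x y h ↦ ?_)
    · refine continuous_pi fun n ↦ ?_
      cases n with
      | zero => exact continuous_const
      | succ n => exact continuous_apply n
    · exact funext fun n ↦ congrFun h (n + 1)
  have hsub (b : Bool) : range (φ ∘ cons b) ⊆ T := (range_comp_subset_range _ _).trans hφT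
  let A : Set T := (↑) ⁻¹' range (φ ∘ cons true)
  have hA : #A = 𝔠 := by
    rw [mk_preimage_of_injective_of_subset_range _ _ Subtype.val_injective
      (by simpa using hsub true), (hcons true).mk_eq_continuum]
  obtain ⟨Y, hcard, hbase, hY, hanti⟩ := exists_antichain_family hT hA
  refine ⟨Y, hcard, hbase, fun S hS ↦ ?_, hanti⟩
  obtain ⟨hnd, hnull⟩ := isNowhereDense_and_volume_eq_zero hK hK0 fun x hx ↦
    ((hY S hS).2 x hx).imp fun t ↦ And.imp_left (@hTK t)
  refine ⟨hnd, hnull, _, ?_, hcons false⟩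
  rintro _ ⟨x, rfl⟩
  refine (hY S hS).1 ⟨⟨_, hsub false ⟨x, rfl⟩⟩, ?_, rfl⟩
  rintro ⟨y, hy⟩
  exact Bool.noConfusion (congrFun (hinj hy) 0)

theorem exists_family_isBernsteinSet :
    ∃ Y : Set (Set ℝ), #Y = 2 ^ 𝔠 ∧ (∀ S ∈ Y, IsTransBase S) ∧ (∀ S ∈ Y, IsBernsteinSet S) ∧
      ∀ R ∈ Y, ∀ S ∈ Y, R ≠ S → ¬ Subfield.closure R ≤ Subfield.closure S := by
  obtain ⟨φ, hφ, hφind⟩ := exists_continuous_algebraicIndependent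
  let C₀ : {C : Set ℝ // IsCantorSet C} := ⟨_, isCantorSet_range hφ hφind.injective⟩
  obtain ⟨x, hind, hx⟩ := exists_algebraicIndependent_mem
    (ι := {C : Set ℝ // IsCantorSet C} × ℝ) (C := fun i ↦ i.1)
    (by
      rw [mk_prod, lift_id, lift_id, mk_real]
      exact (mul_le_mul_left mk_isCantorSet_le 𝔠).trans_eq continuum_mul_self)
    fun i ↦ i.1.2.mk_eq_continuum.ge
  obtain ⟨T, hxT, hT⟩ := exists_isTranscendenceBasis_superset (R := ℚ) hind.coe_range
  have hxinj : Function.Injective x := hind.injective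
  let A : Set T := range fun r : Ioi (0 : ℝ) ↦ ⟨x (C₀, r), hxT (mem_range_self _)⟩
  have hA : #A = 𝔠 := by
    rw [mk_range_eq _ fun r s h ↦ by simpa [Subtype.ext_iff, hxinj.eq_iff] using h, mk_Ioi_real]
  obtain ⟨Y, hcard, hbase, hY, hanti⟩ := exists_antichain_family hT hA
  refine ⟨Y, hcard, hbase, fun S hS ↦ ?_, hanti⟩
  refine isBernsteinSet_of_forall_nonempty_inter (hbase S hS).1 fun C hC ↦
    ⟨x (⟨C, hC⟩, 0), (hY S hS).1 ⟨⟨_, hxT (mem_range_self _)⟩, ?_, rfl⟩, hx (⟨C, hC⟩, 0)⟩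
  rintro ⟨r, hr⟩
  exact r.2.ne' (congrArg Prod.snd (hxinj (congrArg Subtype.val hr)))

/-- Theorem 2: two families 𝒴₁, 𝒴₂ of transcendence bases of size 2^𝔠; members
of 𝒴₁ are nowhere dense null sets containing a Cantor set, members of 𝒴₂ are
Bernstein sets, and for distinct members R, S of the same family,
ℚ(R) ⊄ ℚ(S). -/
theorem exists_transBase_families :
    ∃ Y1 Y2 : Set (Set ℝ),
      Cardinal.mk Y1 = 2 ^ Cardinal.continuum ∧
      Cardinal.mk Y2 = 2 ^ Cardinal.continuum ∧
      (∀ S ∈ Y1 ∪ Y2, IsTransBase S) ∧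
      (∀ S ∈ Y1, IsNowhereDense S ∧ MeasureTheory.volume S = 0 ∧
        ∃ C ⊆ S, IsCantorSet C) ∧
      (∀ S ∈ Y2, IsBernsteinSet S) ∧
      (∀ R ∈ Y1, ∀ S ∈ Y1, R ≠ S → ¬ Subfield.closure R ≤ Subfield.closure S) ∧
      (∀ R ∈ Y2, ∀ S ∈ Y2, R ≠ S → ¬ Subfield.closure R ≤ Subfield.closure S) := by
  obtain ⟨Y₁, hcard₁, hbase₁, hY₁, hanti₁⟩ := exists_family_containing_cantorSet
  obtain ⟨Y₂, hcard₂, hbase₂, hY₂, hanti₂⟩ := exists_family_isBernsteinSet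
  exact ⟨Y₁, Y₂, hcard₁, hcard₂, fun S hS ↦ hS.elim (hbase₁ S) (hbase₂ S), hY₁, hY₂,
    hanti₁, hanti₂⟩
end
end

section
/- There exists a Cantor set C contained in the Cantor ternary set 𝔻 such that C is algebraically independent over ℚ. -/
noncomputable section

open Set Cardinal

/-- The Cantor ternary set `𝔻 = {∑_{n=1}^∞ aₙ 3⁻ⁿ : aₙ ∈ {0,2}}`. -/
def cantorTernarySet : Set ℝ :=
  {x | ∃ a : ℕ → ℝ, (∀ n, a n = 0 ∨ a n = 2) ∧ x = ∑' n : ℕ, a n / 3 ^ (n + 1)}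

open Filter Topology

/-- A continuous injective image of a perfect space has no isolated points. -/
lemma preperfect_range_of_injective {α β : Type*} [TopologicalSpace α] [TopologicalSpace β]
    [PerfectSpace α] {f : α → β} (hf : Continuous f) (hinj : Function.Injective f) :
    Preperfect (range f) := by
  rintro _ ⟨x, rfl⟩
  have h := AccPt.map (PerfectSpace.univ_preperfect x (mem_univ x)) hf.continuousAt hinj
  simpa using h

instance perfectSpace_nat_to_bool : PerfectSpace (ℕ → Bool) := by
  refine perfectSpace_iff_forall_not_isolated.2 fun x ↦ ?_
  have hne : ∀ n, Function.update x n (!x n) ≠ x := fun n h ↦ by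
    simpa using congrFun h n
  have ht : Tendsto (fun n ↦ Function.update x n (!x n)) atTop (𝓝[≠] x) := by
    refine tendsto_nhdsWithin_iff.2 ⟨tendsto_pi_nhds.2 fun i ↦ ?_, Eventually.of_forall hne⟩
    refine tendsto_const_nhds.congr' ?_
    filter_upwards [eventually_gt_atTop i] with n hn
    rw [Function.update_of_ne hn.ne]
  exact ht.neBot

instance perfectSpace_cantorSet : PerfectSpace cantorSet := by
  have h := preperfect_range_of_injective cantorSetHomeomorphNatToBool.symm.continuous
    cantorSetHomeomorphNatToBool.symm.injective
  rw [cantorSetHomeomorphNatToBool.symm.surjective.range_eq] at h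
  exact ⟨h⟩

instance completeSpace_cantorSet : CompleteSpace cantorSet :=
  isClosed_cantorSet.completeSpace_coe

/-- In a perfect Baire space, every nonempty open set escapes every countable set. -/
lemma IsOpen.exists_mem_notMem_of_countable {α : Type*} [TopologicalSpace α] [T1Space α]
    [BaireSpace α] [PerfectSpace α] {V S : Set α} (hV : IsOpen V) (hne : V.Nonempty)
    (hS : S.Countable) : ∃ y ∈ V, y ∉ S := by
  have hd : Dense (⋂ x ∈ S, ({x}ᶜ : Set α)) :=
    dense_biInter_of_isOpen (fun x _ ↦ isOpen_compl_singleton) hS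
      fun x _ ↦ dense_compl_singleton x
  obtain ⟨y, hyV, hy⟩ := hd.inter_open_nonempty V hV hne
  refine ⟨y, hyV, fun hyS ↦ ?_⟩
  simp only [mem_iInter] at hy
  exact hy y hyS rfl

/-- Only countably many reals are algebraic over the subalgebra generated by a countable set. -/
lemma countable_setOf_isAlgebraic_adjoin {s : Set ℝ} (hs : s.Countable) :
    {x : ℝ | IsAlgebraic (Algebra.adjoin ℚ s) x}.Countable := by
  have : Countable (Algebra.adjoin ℚ s) := by
    rw [← Cardinal.mk_le_aleph0_iff]
    refine (Algebra.cardinalMk_adjoin_le ℚ s).trans ?_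
    have := hs.le_aleph0
    simp [this]
  exact Algebraic.countable _ _

/-- Finitely many nonempty open subsets of the Cantor set contain algebraically independent
representatives. -/
lemma exists_algebraicIndependent_mem_of_isOpen (ι : Type) [Finite ι] :
    ∀ V : ι → Set cantorSet, (∀ i, IsOpen (V i)) → (∀ i, (V i).Nonempty) →
      ∃ y : ι → cantorSet, (∀ i, y i ∈ V i) ∧
        AlgebraicIndependent ℚ (fun i ↦ (y i : ℝ)) := by
  induction ι using Finite.induction_empty_option with
  | of_equiv e ih =>
    intro V hV hne
    obtain ⟨y, hy, hind⟩ := ih (V ∘ e) (fun i ↦ hV _) fun i ↦ hne _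
    refine ⟨y ∘ e.symm, fun i ↦ by simpa using hy (e.symm i), ?_⟩
    exact hind.comp e.symm e.symm.injective
  | h_empty =>
    intro V _ _
    refine ⟨isEmptyElim, fun i ↦ i.elim, ?_⟩
    exact algebraicIndependent_empty_type_iff.2 (algebraMap ℚ ℝ).injective
  | h_option ih =>
    intro V hV hne
    obtain ⟨y, hy, hind⟩ := ih (fun i ↦ V (some i)) (fun i ↦ hV _) fun i ↦ hne _
    have hc := (countable_setOf_isAlgebraic_adjoin
      (countable_range fun i ↦ (y i : ℝ))).preimage
        (Subtype.val_injective (p := (· ∈ cantorSet)))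
    obtain ⟨a, haV, ha⟩ := (hV none).exists_mem_notMem_of_countable (hne none) hc
    refine ⟨fun o ↦ o.elim a y, fun o ↦ ?_, ?_⟩
    · cases o with
      | none => exact haV
      | some i => exact hy i
    · convert (hind.option_iff_transcendental (a : ℝ)).2 ha using 2 with o
      cases o <;> rfl

/-- The first `N` digits of a binary sequence. -/
def firstDigits (N : ℕ) (x : ℕ → Bool) : Fin N → Bool := fun i ↦ x i

lemma continuous_firstDigits (N : ℕ) : Continuous (firstDigits N) := by
  unfold firstDigits
  fun_prop

lemma firstDigits_eq_of_le {M N : ℕ} (h : M ≤ N) {x y : ℕ → Bool}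
    (hxy : firstDigits N x = firstDigits N y) : firstDigits M x = firstDigits M y :=
  funext fun i ↦ congrFun hxy (i.castLE h)

lemma exists_firstDigits_injective {n : ℕ} {x : Fin n → ℕ → Bool} (hx : Function.Injective x) :
    ∃ N, Function.Injective fun i ↦ firstDigits N (x i) := by
  have h : ∀ i j, ∃ k, i ≠ j → x i k ≠ x j k := fun i j ↦ by
    by_cases hij : i = j
    · exact ⟨0, fun h ↦ absurd hij h⟩
    · obtain ⟨k, hk⟩ := Function.ne_iff.1 (hx.ne hij)
      exact ⟨k, fun _ ↦ hk⟩
  choose k hk using h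
  obtain ⟨N, hN⟩ := (finite_range fun p : Fin n × Fin n ↦ k p.1 p.2).bddAbove
  refine ⟨N + 1, fun i j hij ↦ ?_⟩
  by_contra hne
  have hlt : k i j < N + 1 := Nat.lt_succ_of_le (hN ⟨(i, j), rfl⟩)
  exact hk i j hne (congrFun hij ⟨k i j, hlt⟩)

/-- A continuous function on the space of binary sequences nearly depends on finitely many
digits. -/
lemma exists_dist_lt_of_firstDigits_eq {α : Type*} [PseudoMetricSpace α]
    (f : C(ℕ → Bool, α)) {ε : ℝ} (hε : 0 < ε) :
    ∃ N, ∀ x y, firstDigits N x = firstDigits N y → dist (f x) (f y) < ε := by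
  by_contra! h
  let K : ℕ → Set ((ℕ → Bool) × (ℕ → Bool)) := fun N ↦
    {p | firstDigits N p.1 = firstDigits N p.2 ∧ ε ≤ dist (f p.1) (f p.2)}
  have hdist : Continuous fun p : (ℕ → Bool) × (ℕ → Bool) ↦ dist (f p.1) (f p.2) := by
    fun_prop
  have hcl : ∀ N, IsClosed (K N) := fun N ↦
    (isClosed_eq ((continuous_firstDigits N).comp continuous_fst)
      ((continuous_firstDigits N).comp continuous_snd)).inter
      (isClosed_le continuous_const hdist)
  obtain ⟨p, hp⟩ := IsCompact.nonempty_iInter_of_sequence_nonempty_isCompact_isClosed K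
    (fun N p hp ↦ ⟨firstDigits_eq_of_le N.le_succ hp.1, hp.2⟩)
    (fun N ↦ let ⟨x, y, hxy⟩ := h N; ⟨(x, y), hxy⟩) (hcl 0).isCompact hcl
  rw [mem_iInter] at hp
  have heq : p.1 = p.2 := funext fun i ↦ congrFun (hp (i + 1)).1 ⟨i, i.lt_succ_self⟩
  have hle := (hp 0).2
  rw [heq, dist_self] at hle
  exact hε.not_ge hle

/-- The maps from binary sequences to the Cantor set such that `P` does not vanish at the images
of any tuple of sequences with distinct `N`-digit prefixes. -/
def nonvanishingMaps (N n : ℕ) (P : MvPolynomial (Fin n) ℚ) : Set C(ℕ → Bool, cantorSet) :=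
  {f | ∀ x : Fin n → ℕ → Bool, (Function.Injective fun i ↦ firstDigits N (x i)) →
    MvPolynomial.aeval (fun i ↦ (f (x i) : ℝ)) P ≠ 0}

lemma isOpen_nonvanishingMaps (N n : ℕ) (P : MvPolynomial (Fin n) ℚ) :
    IsOpen (nonvanishingMaps N n P) := by
  let K : Set (Fin n → ℕ → Bool) := {x | Function.Injective fun i ↦ firstDigits N (x i)}
  have hK : IsCompact K := by
    have hc : Continuous fun (x : Fin n → ℕ → Bool) i ↦ firstDigits N (x i) :=
      continuous_pi fun i ↦ (continuous_firstDigits N).comp (continuous_apply i)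
    exact ((isClosed_discrete {g : Fin n → Fin N → Bool | Function.Injective g}).preimage
      hc).isCompact
  have hcont : Continuous fun q : C(ℕ → Bool, cantorSet) × (Fin n → ℕ → Bool) ↦
      MvPolynomial.aeval (fun i ↦ (q.1 (q.2 i) : ℝ)) P := by
    simp only [MvPolynomial.aeval_eq_eval₂Hom, MvPolynomial.coe_eval₂Hom, MvPolynomial.eval₂_eq]
    fun_prop
  refine isOpen_iff_mem_nhds.2 fun f hf ↦ ?_
  refine hK.eventually_forall_of_forall_eventually fun x hx ↦ ?_
  exact hcont.continuousAt.eventually_ne (hf x hx)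

lemma dense_nonvanishingMaps (N n : ℕ) {P : MvPolynomial (Fin n) ℚ} (hP : P ≠ 0) :
    Dense (nonvanishingMaps N n P) := by
  refine Metric.dense_iff.2 fun f ε hε ↦ ?_
  obtain ⟨M, hM⟩ := exists_dist_lt_of_firstDigits_eq f (half_pos (half_pos hε))
  let L := max M N
  let c : (Fin L → Bool) → ℕ → Bool := fun w i ↦ if h : i < L then w ⟨i, h⟩ else false
  have hc : ∀ w, firstDigits L (c w) = w := fun w ↦ by
    ext i
    simp [firstDigits, c]
  obtain ⟨y, hy, hind⟩ := exists_algebraicIndependent_mem_of_isOpen (Fin L → Bool)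
    (fun w ↦ Metric.ball (f (c w)) (ε / 2 / 2)) (fun _ ↦ Metric.isOpen_ball)
    fun w ↦ ⟨_, Metric.mem_ball_self (half_pos (half_pos hε))⟩
  let g : C(ℕ → Bool, cantorSet) :=
    ⟨fun x ↦ y (firstDigits L x), continuous_of_discreteTopology.comp (continuous_firstDigits L)⟩
  refine ⟨g, ?_, fun x hx h0 ↦ hP ?_⟩
  · refine lt_of_le_of_lt ((ContinuousMap.dist_le (half_pos hε).le).2 fun x ↦ ?_) (half_lt_self hε)
    have h1 : dist (g x) (f (c (firstDigits L x))) < ε / 2 / 2 := hy _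
    have h2 := hM (c (firstDigits L x)) x (firstDigits_eq_of_le (le_max_left M N) (hc _))
    linarith [dist_triangle (g x) (f (c (firstDigits L x))) (f x)]
  · have hinj : Function.Injective fun i ↦ firstDigits L (x i) := fun i j hij ↦
      hx (firstDigits_eq_of_le (le_max_right M N) hij)
    exact (algebraicIndependent_iff.1 (hind.comp _ hinj)) P h0

lemma exists_continuousMap_algebraicIndependent :
    ∃ f : C(ℕ → Bool, cantorSet), AlgebraicIndependent ℚ fun x ↦ (f x : ℝ) := by
  have : Nonempty C(ℕ → Bool, cantorSet) :=
    ⟨(cantorSetHomeomorphNatToBool.symm : C(ℕ → Bool, cantorSet))⟩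
  have : Countable (Σ n, MvPolynomial (Fin n) ℚ) := by
    have (n : ℕ) : Countable (MvPolynomial (Fin n) ℚ) := by
      rw [← Cardinal.mk_le_aleph0_iff]
      exact MvPolynomial.cardinalMk_le_max.trans (by simp)
    infer_instance
  have hd : Dense (⋂ q : ℕ × {P : Σ n, MvPolynomial (Fin n) ℚ // P.2 ≠ 0},
      nonvanishingMaps q.1 q.2.1.1 q.2.1.2) :=
    dense_iInter_of_isOpen (fun _ ↦ isOpen_nonvanishingMaps _ _ _)
      fun q ↦ dense_nonvanishingMaps _ _ q.2.2
  obtain ⟨f, hf⟩ := hd.nonempty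
  refine ⟨f, algebraicIndependent_iff.2 fun p hp ↦ ?_⟩
  obtain ⟨n, e, he, q, rfl⟩ := MvPolynomial.exists_fin_rename p
  by_contra hne
  have hq : q ≠ 0 := by
    rintro rfl
    exact hne (map_zero _)
  obtain ⟨N, hN⟩ := exists_firstDigits_injective he
  rw [MvPolynomial.aeval_rename] at hp
  exact mem_iInter.1 hf (N, ⟨⟨n, q⟩, hq⟩) e hN hp

lemma cantorSet_subset_cantorTernarySet : cantorSet ⊆ cantorTernarySet := by
  intro x hx
  rw [cantorSet_eq_zero_two_ofDigits] at hx
  obtain ⟨a, ha, rfl⟩ := hx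
  refine ⟨fun n ↦ (a n : ℕ), fun n ↦ ?_, ?_⟩
  · have h : ∀ d : Fin 3, d ≠ 1 → d = 0 ∨ d = 2 := by decide
    rcases h _ (ha n) with h | h <;> simp [h]
  · simp [Real.ofDigits, Real.ofDigitsTerm, div_eq_mul_inv]

/-- There exists an algebraically independent Cantor set lying in the
Cantor ternary set. -/
theorem exists_algIndep_cantorSet_subset_ternary :
    ∃ C : Set ℝ, C ⊆ cantorTernarySet ∧ IsCantorSet C ∧ AlgIndepSet C := by
  obtain ⟨f, hf⟩ := exists_continuousMap_algebraicIndependent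
  have hcont : Continuous fun x ↦ (f x : ℝ) := by fun_prop
  have hemb := (hcont.isClosedEmbedding hf.injective).isEmbedding
  refine ⟨range fun x ↦ (f x : ℝ), ?_, ⟨range_nonempty _, isCompact_range hcont,
    hemb.isTotallyDisconnected_range.2 inferInstance,
    preperfect_range_of_injective hcont hf.injective⟩, hf.coe_range⟩
  rintro _ ⟨x, rfl⟩
  exact cantorSet_subset_cantorTernarySet (f x).2
end
end
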